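/- Let X be the space of sequences over {0_0, 0_1, 1} with allowed two-letter subwords {0_00_1, 0_10_0, 0_11, 10_0, 10_1, 11}, let P : X → {0,1}^∞ be the map erasing the indices of 0_0 and 0_1, and let a_0, a_1, b, c, d be the transformations of X defined above. Then: (i) a_0 and a_1 are involutions of X with disjoint supports (no point of X is moved by both); (ii) P intertwines the lifted action with the Grigorchuk action: for every ξ ∈ X one has P(ξ·(a_0a_1)) = P(ξ)·a, P(ξ·b) = P(ξ)·b, P(ξ·c) = P(ξ)·c, and P(ξ·d) = P(ξ)·d, where a, b, c, d on the right-hand sides are the generators of the first Grigorchuk group acting on {0,1}^∞. -/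

import Mathlib

noncomputable section
open scoped Classical

namespace SimpleGrig

/-- The alphabet `{0₀, 0₁, 1}`. -/
inductive GA : Type
  | z0 : GA  -- the letter `0₀`
  | z1 : GA  -- the letter `0₁`
  | one : GA -- the letter `1`
  deriving DecidableEq

/-- The allowed two-letter subwords
`{0₀0₁, 0₁0₀, 0₁1, 10₀, 10₁, 11}`. -/
def allowedPair : GA → GA → Prop
  | GA.z0, q => q = GA.z1
  | GA.z1, q => q ≠ GA.z1
  | GA.one, _ => True

/-- The space `X` of sequences over `{0₀, 0₁, 1}` in which every two-letter
subword is allowed. -/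
def GX : Set (ℕ → GA) := {w | ∀ n : ℕ, allowedPair (w n) (w (n + 1))}

/-- Shift a sequence by `k` letters. -/
def shiftBy (k : ℕ) (w : ℕ → GA) : ℕ → GA := fun n => w (n + k)

/-- The lift `a` of the Grigorchuk generator `a` to `X`:
`(0ₓw)·a = 1w`, `(10ₓw)·a = 0_{1−x}0ₓw`, `(11w)·a = 0₁1w`
(only the first letter changes). -/
def hatA (w : ℕ → GA) : ℕ → GA := fun n =>
  if n = 0 then
    (match w 0, w 1 with
      | GA.z0, _ => GA.one
      | GA.z1, _ => GA.one
      | GA.one, GA.z0 => GA.z1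
      | GA.one, GA.z1 => GA.z0
      | GA.one, GA.one => GA.z1)
  else w n

/-- The involution `a₀`: swaps `10₁w ↔ 0₀0₁w` and fixes all other sequences. -/
def hatA0 (w : ℕ → GA) : ℕ → GA := fun n =>
  if n = 0 then
    (match w 0, w 1 with
      | GA.one, GA.z1 => GA.z0
      | GA.z0, GA.z1 => GA.one
      | p, _ => p)
  else w n

/-- The involution `a₁`: swaps `1xw ↔ 0₁xw` for `x ∈ {0₀, 1}` and fixes all
other sequences. -/
def hatA1 (w : ℕ → GA) : ℕ → GA := fun n =>
  if n = 0 then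
    (match w 0, w 1 with
      | GA.one, GA.z0 => GA.z1
      | GA.one, GA.one => GA.z1
      | GA.z1, GA.z0 => GA.one
      | GA.z1, GA.one => GA.one
      | p, _ => p)
  else w n

/-- Given the (new) second letter of a sequence, the unique letter `0_δ` which may
precede it. -/
def headFix : GA → GA
  | GA.one => GA.z1
  | GA.z0 => GA.z1
  | GA.z1 => GA.z0

/-- The action of `b`, `c`, `d` on a sequence starting with a letter `0ₓ`:
the tail gets `a` applied, and the first letter becomes the unique `0_δ`
compatible with the new second letter.  This encodes the rules
`(0_{1−x}0ₓw)·b = 0₁(0ₓw·a)`, `(0₁10ₓw)·b = 0ₓ(10ₓw·a)`, `(0₁11w)·b = 0₀(11w·a)`. -/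
def zeroCase (w : ℕ → GA) : ℕ → GA := fun n =>
  if n = 0 then headFix (hatA (shiftBy 1 w) 0) else hatA (shiftBy 1 w) (n - 1)

/-- The position of the first letter of `w` different from `1`. -/
def firstNotOne (w : ℕ → GA) : ℕ := sInf {n | w n ≠ GA.one}

/-- The common pattern of the lifted generators `b`, `c`, `d`: if `w = 1^k 0ₓ …`,
then the suffix starting at position `k` undergoes `zeroCase` iff `k % 3 ≠ r`
(and sequences without any `0ₓ` are fixed).  For `r = 2` this is exactly the lift
of `b`, defined recursively by the `zeroCase` rules and `(1w)·b = 1(w·c)`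
(similarly `r = 1` for `c` and `r = 0` for `d`). -/
def hatStep (r : ℕ) (w : ℕ → GA) : ℕ → GA :=
  if ∃ n, w n ≠ GA.one then
    (if (firstNotOne w) % 3 ≠ r then
      (fun n => if n < firstNotOne w then w n
                else zeroCase (shiftBy (firstNotOne w) w) (n - firstNotOne w))
     else w)
  else w

/-- The lift of the Grigorchuk generator `b` to `X`. -/
def hatB : (ℕ → GA) → ℕ → GA := hatStep 2
/-- The lift of the Grigorchuk generator `c` to `X`. -/
def hatC : (ℕ → GA) → ℕ → GA := hatStep 1
/-- The lift of the Grigorchuk generator `d` to `X`. -/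
def hatD : (ℕ → GA) → ℕ → GA := hatStep 0


/-! The first Grigorchuk group acting on `{0,1}^∞`. -/

/-- Infinite binary sequences (`false` = 0, `true` = 1). -/
abbrev Seq := ℕ → Bool

/-- Flip the letter at position `k`. -/
def flipAt (k : ℕ) (w : Seq) : Seq := fun n => if n = k then !(w n) else w n

/-- The Grigorchuk generator `a`: flip the first letter. -/
def genA : Seq → Seq := flipAt 0

/-- The position of the first `0` in `w`. -/
def firstZero (w : Seq) : ℕ := sInf {n | w n = false}

/-- The common pattern of the Grigorchuk generators `b`, `c`, `d`: if `w = 1^k 0 …`,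
flip the letter in position `k + 1` iff `k % 3 ≠ r`.  `r = 2, 1, 0` give the
generators `b`, `c`, `d` defined recursively by `(0w)·b = 0(w·a)`, `(1w)·b = 1(w·c)`,
`(0w)·c = 0(w·a)`, `(1w)·c = 1(w·d)`, `(0w)·d = 0w`, `(1w)·d = 1(w·b)`. -/
def genStep (r : ℕ) (w : Seq) : Seq :=
  if ∃ n, w n = false then
    (if (firstZero w) % 3 ≠ r then flipAt (firstZero w + 1) w else w)
  else w

/-- The Grigorchuk generator `b`. -/
def genB : Seq → Seq := genStep 2
/-- The Grigorchuk generator `c`. -/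
def genC : Seq → Seq := genStep 1
/-- The Grigorchuk generator `d`. -/
def genD : Seq → Seq := genStep 0

/-- The map `P : X → {0,1}^∞` erasing the indices of `0₀` and `0₁`. -/
def eraseIndices (w : ℕ → GA) : Seq := fun n => if w n = GA.one then true else false

/-- Erasing indices negates the letter on which `hatA` acts. -/
theorem eraseIndices_hatA (w : ℕ → GA) : eraseIndices (hatA w) = genA (eraseIndices w) := by
  funext n
  rcases Nat.eq_zero_or_pos n with rfl | hn
  · cases h0 : w 0 <;> cases h1 : w 1 <;>
      simp [eraseIndices, hatA, genA, flipAt, h0, h1]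
  · simp [eraseIndices, hatA, genA, flipAt, hn.ne']

theorem eraseIndices_hatA1_hatA0 {w : ℕ → GA} (hw : w ∈ GX) :
    eraseIndices (hatA1 (hatA0 w)) = genA (eraseIndices w) := by
  funext n
  rcases Nat.eq_zero_or_pos n with rfl | hn
  · have h := hw 0
    cases h0 : w 0 <;> cases h1 : w 1 <;>
      simp_all [eraseIndices, hatA0, hatA1, genA, flipAt, allowedPair]
  · simp [eraseIndices, hatA0, hatA1, genA, flipAt, hn.ne']

theorem hatA0_mem_GX {w : ℕ → GA} (hw : w ∈ GX) : hatA0 w ∈ GX := by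
  intro n
  have h := hw n
  rcases Nat.eq_zero_or_pos n with rfl | hn
  · cases h0 : w 0 <;> cases h1 : w 1 <;> simp_all [hatA0, allowedPair]
  · simpa [hatA0, hn.ne'] using h

theorem hatA1_mem_GX {w : ℕ → GA} (hw : w ∈ GX) : hatA1 w ∈ GX := by
  intro n
  have h := hw n
  rcases Nat.eq_zero_or_pos n with rfl | hn
  · cases h0 : w 0 <;> cases h1 : w 1 <;> simp_all [hatA1, allowedPair]
  · simpa [hatA1, hn.ne'] using h

theorem hatA0_involutive : Function.Involutive hatA0 := by
  intro w
  funext n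
  rcases Nat.eq_zero_or_pos n with rfl | hn
  · cases h0 : w 0 <;> cases h1 : w 1 <;> simp [hatA0, h0, h1]
  · simp [hatA0, hn.ne']

theorem hatA1_involutive : Function.Involutive hatA1 := by
  intro w
  funext n
  rcases Nat.eq_zero_or_pos n with rfl | hn
  · cases h0 : w 0 <;> cases h1 : w 1 <;> simp [hatA1, h0, h1]
  · simp [hatA1, hn.ne']

theorem hatA0_eq_or_hatA1_eq (w : ℕ → GA) : hatA0 w = w ∨ hatA1 w = w := by
  simp only [funext_iff]
  by_cases h : w 1 = GA.z1
  · right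
    intro n
    rcases Nat.eq_zero_or_pos n with rfl | hn
    · cases h0 : w 0 <;> simp [hatA1, h0, h]
    · simp [hatA1, hn.ne']
  · left
    intro n
    rcases Nat.eq_zero_or_pos n with rfl | hn
    · cases h0 : w 0 <;> cases h1 : w 1 <;> simp_all [hatA0]
    · simp [hatA0, hn.ne']

theorem eraseIndices_congr {v w : ℕ → GA} {m n : ℕ} (h : v m = w n) :
    eraseIndices v m = eraseIndices w n := by
  simp only [eraseIndices, h]

theorem eraseIndices_eq_false {w : ℕ → GA} {n : ℕ} :
    eraseIndices w n = false ↔ w n ≠ GA.one := by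
  simp [eraseIndices]

theorem firstZero_eraseIndices (w : ℕ → GA) : firstZero (eraseIndices w) = firstNotOne w := by
  simp only [firstZero, firstNotOne, eraseIndices_eq_false]

theorem headFix_ne_one (x : GA) : headFix x ≠ GA.one := by
  cases x <;> simp [headFix]

/-- On a sequence starting with some `0ₓ`, the map `zeroCase` lifts the flip of the second
letter. -/
theorem eraseIndices_zeroCase {w : ℕ → GA} (hw : w 0 ≠ GA.one) :
    eraseIndices (zeroCase w) = flipAt 1 (eraseIndices w) := by
  funext n
  cases n with
  | zero => simp [eraseIndices, zeroCase, flipAt, headFix_ne_one, hw]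
  | succ n =>
    refine (congrFun (eraseIndices_hatA (shiftBy 1 w)) n).trans ?_
    by_cases hn : n = 0 <;> simp [genA, flipAt, hn] <;> rfl

theorem eraseIndices_hatStep (r : ℕ) (w : ℕ → GA) :
    eraseIndices (hatStep r w) = genStep r (eraseIndices w) := by
  simp only [hatStep, genStep, eraseIndices_eq_false, firstZero_eraseIndices]
  split_ifs with hex hr
  · have hk : w (firstNotOne w) ≠ GA.one := Nat.sInf_mem (s := {n | w n ≠ GA.one}) hex
    generalize firstNotOne w = k at hk
    funext n
    rcases lt_or_ge n k with hn | hn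
    · have hne : n ≠ k + 1 := by omega
      simp [eraseIndices, flipAt, hn, hne]
    · obtain ⟨m, rfl⟩ := Nat.exists_eq_add_of_le' hn
      refine (eraseIndices_congr (w := zeroCase (shiftBy k w)) (n := m) (by simp)).trans ?_
      rw [eraseIndices_zeroCase (by simpa [shiftBy] using hk)]
      have hiff : m + k = k + 1 ↔ m = 1 := by omega
      have hs : eraseIndices (shiftBy k w) m = eraseIndices w (m + k) := rfl
      simp only [flipAt, hiff, hs]
  · rfl
  · rfl

/-- (i) `a₀` and `a₁` are involutions of `X` with disjoint
supports (no point of `X` is moved by both); (ii) the map `P` erasing the indices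
intertwines the lifted action with the Grigorchuk action: for every `ξ ∈ X` one has
`P(ξ·(a₀a₁)) = P(ξ)·a`, `P(ξ·b) = P(ξ)·b`, `P(ξ·c) = P(ξ)·c`, `P(ξ·d) = P(ξ)·d`. -/
theorem lift_intertwines_grigorchuk :
    (∀ ξ ∈ GX,
      hatA0 ξ ∈ GX ∧ hatA1 ξ ∈ GX ∧
      hatA0 (hatA0 ξ) = ξ ∧ hatA1 (hatA1 ξ) = ξ ∧
      (hatA0 ξ = ξ ∨ hatA1 ξ = ξ)) ∧
    (∀ ξ ∈ GX,
      eraseIndices (hatA1 (hatA0 ξ)) = genA (eraseIndices ξ) ∧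
      eraseIndices (hatB ξ) = genB (eraseIndices ξ) ∧
      eraseIndices (hatC ξ) = genC (eraseIndices ξ) ∧
      eraseIndices (hatD ξ) = genD (eraseIndices ξ)) := by
  refine ⟨fun ξ hξ => ⟨hatA0_mem_GX hξ, hatA1_mem_GX hξ, hatA0_involutive ξ,
      hatA1_involutive ξ, hatA0_eq_or_hatA1_eq ξ⟩, fun ξ hξ => ⟨eraseIndices_hatA1_hatA0 hξ,
      eraseIndices_hatStep 2 ξ, eraseIndices_hatStep 1 ξ, eraseIndices_hatStep 0 ξ⟩⟩

end SimpleGrig
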